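/- arXiv:2310.15559 — 6 statements merged into one kernel-verified Lean document; each statement's English description precedes it below -/
import Mathlib

section
/- Let n ≥ 1, T ≥ 1, let η ∈ (0, 1/2], let m_1, …, m_T ∈ ℝ^n be loss vectors with m_t(i) ∈ [-1, 1] for all i ∈ [n] and t ∈ [T], and let φ_1 ∈ ℝ^n have strictly positive entries. Define φ_{t+1}(i) = φ_t(i)(1 − η m_t(i)) for all i ∈ [n] and t ∈ [T]. Then every φ_t has strictly positive entries, and for every i ∈ [n]: Σ_{t=1}^T ( ⟨φ_t/‖φ_t‖₁, m_t⟩ − m_t(i) ) ≤ η Σ_{t=1}^T |m_t(i)| + ln(‖φ_1‖₁ / φ_1(i)) / η. -/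
theorem mw_log_aux (x : ℝ) (hx : |x| ≤ 1 / 2) : -Real.log (1 - x) ≤ x + x ^ 2 := by
  have h := Real.abs_log_sub_add_sum_range_le (x := x) (by linarith) 4
  have h2 : |x| ^ (4 + 1) / (1 - |x|) ≤ 2 * |x| ^ 5 := by
    have h0 := abs_nonneg x
    rw [div_le_iff₀ (by linarith)]
    have h5 : 0 ≤ |x| ^ 5 := by positivity
    have h8 := mul_nonneg h5 (sub_nonneg.2 hx)
    have h9 : 2 * |x| ^ 5 * (1 - |x|) = |x| ^ (4 + 1) + 2 * (|x| ^ 5 * (1 / 2 - |x|)) := by ring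
    rw [h9]
    exact le_add_of_nonneg_right (mul_nonneg zero_le_two h8)
  have h7 : |x| ^ 5 ≤ x ^ 2 * (1 / 8) := by
    have h3 : |x| ^ 3 ≤ (1 / 2) ^ 3 := pow_le_pow_left₀ (abs_nonneg x) hx 3
    calc |x| ^ 5 = |x| ^ 2 * |x| ^ 3 := by ring
      _ ≤ |x| ^ 2 * (1 / 2) ^ 3 := by gcongr
      _ = _ := by rw [sq_abs]; ring
  have h4 := (abs_le.1 (h.trans h2)).1
  simp only [Finset.sum_range_succ, Finset.sum_range_zero] at h4
  norm_num at h4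
  obtain ⟨ha, hb⟩ := abs_le.1 hx
  have h5 : 0 ≤ x ^ 2 * (1 / 4 - x / 3 - x ^ 2 / 4) := by
    apply mul_nonneg (sq_nonneg x)
    nlinarith
  have h6 : 0 ≤ x ^ 2 := sq_nonneg x
  nlinarith

/-- **Multiplicative Weights regret bound** (Theorem 2.1 of Arora–Hazan–Kale, generalized to an
arbitrary positive initialization `φ 0`).  Indices are shifted so that round `t ∈ {1,…,T}` of the
paper corresponds to `t ∈ {0,…,T-1}` here, and `φ 0` plays the role of `φ_1`. -/
theorem mw_regret (n T : ℕ) (hn : 1 ≤ n) (hT : 1 ≤ T)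
    (η : ℝ) (hη0 : 0 < η) (hη : η ≤ 1 / 2)
    (m : ℕ → Fin n → ℝ) (hm : ∀ t < T, ∀ i, m t i ∈ Set.Icc (-1 : ℝ) 1)
    (φ : ℕ → Fin n → ℝ) (hφ1 : ∀ i, 0 < φ 0 i)
    (hrec : ∀ t < T, ∀ i, φ (t + 1) i = φ t i * (1 - η * m t i)) :
    (∀ t ≤ T, ∀ i, 0 < φ t i) ∧
    ∀ i, ∑ t ∈ Finset.range T, ((∑ j, φ t j / (∑ k, |φ t k|) * m t j) - m t i)
      ≤ η * ∑ t ∈ Finset.range T, |m t i|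
        + Real.log ((∑ k, |φ 0 k|) / φ 0 i) / η := by
  have hx : ∀ t < T, ∀ i, |η * m t i| ≤ 1 / 2 := by
    intro t ht i
    have h1 : |m t i| ≤ 1 := abs_le.2 (hm t ht i)
    rw [abs_mul, abs_of_pos hη0]
    nlinarith [abs_nonneg (m t i)]
  have hpos : ∀ t ≤ T, ∀ i, 0 < φ t i := by
    intro t
    induction t with
    | zero => exact fun _ => hφ1
    | succ t ih =>
      intro ht i
      rw [hrec t (by omega) i]
      have := (abs_le.1 (hx t (by omega) i)).2
      exact mul_pos (ih (by omega) i) (by linarith)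
  refine ⟨hpos, fun i => ?_⟩
  have hS : ∀ t ≤ T, ∑ k, |φ t k| = ∑ k, φ t k := fun t ht =>
    Finset.sum_congr rfl fun k _ => abs_of_pos (hpos t ht k)
  have hle : ∀ t ≤ T, φ t i ≤ ∑ k, |φ t k| := fun t ht => by
    rw [hS t ht]
    exact Finset.single_le_sum (fun k _ => (hpos t ht k).le) (Finset.mem_univ i)
  have key : ∀ t < T, (∑ j, φ t j / (∑ k, |φ t k|) * m t j) - m t i ≤ η * |m t i|
      + (Real.log ((∑ k, |φ t k|) / φ t i) - Real.log ((∑ k, |φ (t + 1) k|) / φ (t + 1) i)) / η := by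
    intro t ht
    have hSp : 0 < ∑ k, |φ t k| := (hpos t ht.le i).trans_le (hle t ht.le)
    have hSp' : 0 < ∑ k, |φ (t + 1) k| := (hpos (t + 1) ht i).trans_le (hle (t + 1) ht)
    have hSrec : ∑ k, |φ (t + 1) k|
        = (∑ k, |φ t k|) * (1 - η * ∑ j, φ t j / (∑ k, |φ t k|) * m t j) := by
      have e : ∑ j, φ t j / (∑ k, |φ t k|) * m t j = (∑ j, φ t j * m t j) / (∑ k, |φ t k|) := by
        rw [Finset.sum_div]
        exact Finset.sum_congr rfl fun j _ => by ring
      rw [e, mul_sub, mul_one, mul_left_comm, mul_div_cancel₀ _ hSp.ne', hS t ht.le,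
        hS (t + 1) ht, Finset.mul_sum, ← Finset.sum_sub_distrib]
      exact Finset.sum_congr rfl fun j _ => by rw [hrec t ht j]; ring
    set S := ∑ k, |φ t k| with hSdef
    set p := ∑ j, φ t j / S * m t j with hp
    have hq : 0 < 1 - η * p := by
      rw [hSrec] at hSp'
      exact pos_of_mul_pos_right hSp' hSp.le
    have hr : 0 < 1 - η * m t i := by
      have := (abs_le.1 (hx t ht i)).2
      linarith
    have hφ := hpos t ht.le i
    rw [hSrec, hrec t ht i, Real.log_div (by positivity) (by positivity),
      Real.log_div (by positivity) (by positivity), Real.log_mul (by positivity) (by positivity),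
      Real.log_mul (by positivity) (by positivity)]
    have h1 := Real.log_le_sub_one_of_pos hq
    have h2 := mw_log_aux _ (hx t ht i)
    have h3 : m t i ^ 2 ≤ |m t i| := by
      have h1 : |m t i| ≤ 1 := abs_le.2 (hm t ht i)
      rw [← sq_abs]
      nlinarith [abs_nonneg (m t i)]
    have h4 : (η * m t i) ^ 2 ≤ η ^ 2 * |m t i| := by
      rw [mul_pow]; gcongr
    rw [← sub_le_iff_le_add', le_div_iff₀ hη0]
    linarith
  have h := Finset.sum_le_sum fun t ht => key t (Finset.mem_range.1 ht)
  rw [Finset.sum_add_distrib, ← Finset.mul_sum, ← Finset.sum_div,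
    Finset.sum_range_sub' (fun t => Real.log ((∑ k, |φ t k|) / φ t i))] at h
  refine h.trans ?_
  have hl : 0 ≤ Real.log ((∑ k, |φ T k|) / φ T i) :=
    Real.log_nonneg ((one_le_div (hpos T le_rfl i)).2 (hle T le_rfl))
  gcongr
  linarith
end

section
/- Let A_1, …, A_T ∈ ℝ^{n×n} be symmetric matrices that share a common full set of orthonormal eigenvectors v_1, …, v_n and whose eigenvalues all lie in [-1, 1]. Run Oja's algorithm: w_1 is a unit vector in ℝ^n, z_t = w_t/‖w_t‖₂, w_{t+1} = (I + μ A_t) w_t, with step size μ ∈ (0, 1/6]. Assume z_1ᵀ v_i ≠ 0. Then for any i ∈ [n]: Σ_{t=1}^T ( v_iᵀ A_t v_i − z_tᵀ A_t z_t ) ≤ μ Σ_{t=1}^T ( 3 |v_iᵀ A_t v_i| + (1/2) ‖A_t‖₂² ) − ln((z_1ᵀ v_i)²)/(2μ). -/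
open Matrix

/-- The spectral norm (largest singular value) of a real square matrix, i.e. the operator norm
of the induced linear map on Euclidean space. -/
noncomputable def specNorm {n : ℕ} (A : Matrix (Fin n) (Fin n) ℝ) : ℝ :=
  ‖Matrix.toEuclideanCLM (𝕜 := ℝ) A‖

lemma oja_log_lower (x : ℝ) (hx : |x| ≤ 1 / 6) : x - 2 * x ^ 2 ≤ Real.log (1 + x) := by
  have h := abs_le.mp hx
  have hp : 0 < 1 + x := by linarith
  have h1 := Real.one_sub_inv_le_log_of_pos hp
  refine le_trans ?_ h1
  have : 1 - (1 + x)⁻¹ = x / (1 + x) := by field_simp; ring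
  rw [this, le_div_iff₀ hp]
  nlinarith [sq_nonneg x, mul_nonneg (sq_nonneg x) (by linarith : (0:ℝ) ≤ 1 + 2 * x)]

lemma oja_dot_self {n : ℕ} (x : EuclideanSpace ℝ (Fin n)) : (x ⬝ᵥ x : ℝ) = ‖x‖ ^ 2 := by
  rw [EuclideanSpace.real_norm_sq_eq]
  simp [dotProduct, sq]

lemma oja_specNorm {n : ℕ} (A : Matrix (Fin n) (Fin n) ℝ) (x : EuclideanSpace ℝ (Fin n)) :
    (A.mulVec x ⬝ᵥ A.mulVec x : ℝ) ≤ specNorm A ^ 2 * ‖x‖ ^ 2 := by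
  have h := (Matrix.toEuclideanCLM (𝕜 := ℝ) A).le_opNorm x
  have h2 := oja_dot_self (Matrix.toEuclideanCLM (𝕜 := ℝ) A x)
  rw [Matrix.ofLp_toEuclideanCLM] at h2
  rw [h2, ← mul_pow]
  exact pow_le_pow_left₀ (norm_nonneg _) h 2

lemma oja_real_step (μ l c N Q B s : ℝ) (hμ0 : 0 < μ) (hμ : μ ≤ 1 / 6) (hl : |l| ≤ 1)
    (hc : c ≠ 0) (hN : 0 < N) (hB : B ≤ s ^ 2 * N)
    (hN' : 0 < N + 2 * μ * Q + μ ^ 2 * B) :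
    l - Q / N ≤ μ * (3 * |l| + 1 / 2 * s ^ 2) +
      (Real.log (((1 + μ * l) * c) ^ 2 / (N + 2 * μ * Q + μ ^ 2 * B))
        - Real.log (c ^ 2 / N)) / (2 * μ) := by
  have hx : |μ * l| ≤ 1 / 6 := by
    rw [abs_mul, abs_of_pos hμ0]; nlinarith [abs_nonneg l]
  have hlog := oja_log_lower _ hx
  have hpos : 0 < 1 + μ * l := by linarith [(abs_le.mp hx).1]
  have hR : N + 2 * μ * Q + μ ^ 2 * B = N * (1 + 2 * μ * (Q / N) + μ ^ 2 * (B / N)) := by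
    field_simp
  have hRp : 0 < 1 + 2 * μ * (Q / N) + μ ^ 2 * (B / N) := by
    rw [hR] at hN'; exact pos_of_mul_pos_right hN' hN.le
  have hub := Real.log_le_sub_one_of_pos hRp
  have hBN : B / N ≤ s ^ 2 := by rw [div_le_iff₀ hN]; exact hB
  have hl2 : l ^ 2 ≤ |l| := by rw [← sq_abs]; nlinarith [abs_nonneg l]
  rw [hR, Real.log_div (by positivity) (by positivity), Real.log_div (by positivity) (by positivity),
    mul_pow, Real.log_mul (by positivity) (by positivity), Real.log_mul hN.ne' hRp.ne',
    Real.log_pow (n := 2) (x := 1 + μ * l)]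
  rw [← sub_le_iff_le_add', le_div_iff₀ (by positivity)]
  push_cast
  nlinarith [mul_le_mul_of_nonneg_left hBN (sq_nonneg μ),
    mul_le_mul_of_nonneg_left hl2 (sq_nonneg μ), mul_nonneg (sq_nonneg μ) (abs_nonneg l)]

/-- **Regret bound for Oja's algorithm under a common-eigenvectors assumption (Theorem 2).**
Indices are shifted so that round `t ∈ {1,…,T}` of the paper corresponds to `t ∈ {0,…,T-1}`
here; in particular `w 0` is the initial unit vector `w_1` and `z 0 = z_1`. -/
theorem oja_regret_common_basis (n T : ℕ) (μ : ℝ) (hμ0 : 0 < μ) (hμ : μ ≤ 1 / 6)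
    (A : ℕ → Matrix (Fin n) (Fin n) ℝ) (hA : ∀ t < T, (A t).IsSymm)
    (v : Fin n → EuclideanSpace ℝ (Fin n)) (hv : Orthonormal ℝ v)
    (lam : ℕ → Fin n → ℝ)
    (heig : ∀ t < T, ∀ i, (A t).mulVec (v i) = lam t i • v i)
    (hlam : ∀ t < T, ∀ i, |lam t i| ≤ 1)
    (w : ℕ → EuclideanSpace ℝ (Fin n)) (hw1 : ‖w 0‖ = 1)
    (hrec : ∀ t, w (t + 1) = (1 + μ • A t).mulVec (w t))
    (z : ℕ → EuclideanSpace ℝ (Fin n)) (hz : ∀ t, z t = ‖w t‖⁻¹ • w t)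
    (i : Fin n) (hinit : z 0 ⬝ᵥ v i ≠ 0) :
    ∑ t ∈ Finset.range T, (v i ⬝ᵥ (A t).mulVec (v i) - z t ⬝ᵥ (A t).mulVec (z t))
      ≤ μ * ∑ t ∈ Finset.range T,
            (3 * |v i ⬝ᵥ (A t).mulVec (v i)| + 1 / 2 * specNorm (A t) ^ 2)
        - Real.log ((z 0 ⬝ᵥ v i) ^ 2) / (2 * μ) := by
  have hvv : (v i ⬝ᵥ v i : ℝ) = 1 := by rw [oja_dot_self, hv.1 i]; norm_num
  have hvA : ∀ t < T, (v i ⬝ᵥ (A t).mulVec (v i) : ℝ) = lam t i := by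
    intro t ht
    rw [heig t ht i]
    simp [dotProduct_smul, hvv]
  have hzv : ∀ t, (z t ⬝ᵥ v i : ℝ) ^ 2 = (w t ⬝ᵥ v i) ^ 2 / ‖w t‖ ^ 2 := by
    intro t
    rw [hz t]
    simp only [WithLp.ofLp_smul, smul_dotProduct, smul_eq_mul]
    rw [mul_pow, inv_pow]; ring
  have hzA : ∀ t, (z t ⬝ᵥ (A t).mulVec (z t) : ℝ) = (w t ⬝ᵥ (A t).mulVec (w t)) / ‖w t‖ ^ 2 := by
    intro t
    rw [hz t]
    simp only [WithLp.ofLp_smul, smul_dotProduct, mulVec_smul, dotProduct_smul, smul_eq_mul]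
    rw [div_eq_inv_mul, ← inv_pow]; ring
  have hrec' : ∀ t, (w (t + 1) : Fin n → ℝ) = (w t : Fin n → ℝ) + μ • (A t).mulVec (w t) := by
    intro t
    rw [hrec t, add_mulVec, one_mulVec, smul_mulVec]
  have hc : ∀ t < T, (w (t + 1) ⬝ᵥ v i : ℝ) = (1 + μ * lam t i) * (w t ⬝ᵥ v i) := by
    intro t ht
    have hs : ((A t).mulVec (w t) ⬝ᵥ v i : ℝ) = lam t i * (w t ⬝ᵥ v i) := by
      rw [dotProduct_comm, dotProduct_mulVec, ← mulVec_transpose, (hA t ht).eq, heig t ht i,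
        smul_dotProduct, smul_eq_mul, dotProduct_comm]
    rw [hrec' t, add_dotProduct, smul_dotProduct, hs, smul_eq_mul]; ring
  have hN : ∀ t, ‖w (t + 1)‖ ^ 2 = ‖w t‖ ^ 2 + 2 * μ * (w t ⬝ᵥ (A t).mulVec (w t))
      + μ ^ 2 * ((A t).mulVec (w t) ⬝ᵥ (A t).mulVec (w t)) := by
    intro t
    rw [← oja_dot_self, ← oja_dot_self, hrec' t]
    simp only [add_dotProduct, dotProduct_add, smul_dotProduct, dotProduct_smul, smul_eq_mul]
    rw [dotProduct_comm ((A t).mulVec (w t)) (w t)]; ring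
  have hpos : ∀ t, (w t ⬝ᵥ v i : ℝ) ≠ 0 → 0 < ‖w t‖ ^ 2 := by
    intro t h
    have : w t ≠ 0 := by
      intro h0; apply h; rw [h0]; simp
    positivity
  have key : ∀ k ≤ T, (w k ⬝ᵥ v i : ℝ) ≠ 0 ∧
      ∑ t ∈ Finset.range k, (v i ⬝ᵥ (A t).mulVec (v i) - z t ⬝ᵥ (A t).mulVec (z t))
      ≤ μ * ∑ t ∈ Finset.range k,
            (3 * |v i ⬝ᵥ (A t).mulVec (v i)| + 1 / 2 * specNorm (A t) ^ 2)
        + (Real.log ((z k ⬝ᵥ v i) ^ 2) - Real.log ((z 0 ⬝ᵥ v i) ^ 2)) / (2 * μ) := by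
    intro k
    induction k with
    | zero =>
      intro _
      refine ⟨?_, by simp⟩
      intro h
      apply hinit
      have := hzv 0
      rw [h] at this
      simpa using this
    | succ k ih =>
      intro hk
      have hkT : k < T := hk
      obtain ⟨h0, hs⟩ := ih hkT.le
      have hx : |μ * lam k i| ≤ 1 / 6 := by
        rw [abs_mul, abs_of_pos hμ0]; nlinarith [abs_nonneg (lam k i), hlam k hkT i]
      have h1 : (w (k + 1) ⬝ᵥ v i : ℝ) ≠ 0 := by
        rw [hc k hkT]
        exact mul_ne_zero (by linarith [(abs_le.mp hx).1]) h0
      refine ⟨h1, ?_⟩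
      have hN' := hpos _ h1
      rw [hN k] at hN'
      have hst := oja_real_step μ (lam k i) _ _ _ _ (specNorm (A k)) hμ0 hμ (hlam k hkT i) h0
        (hpos k h0) (oja_specNorm (A k) (w k)) hN'
      rw [← hN k, ← hc k hkT, ← hzv, ← hzv, ← hzA, ← hvA k hkT] at hst
      rw [Finset.sum_range_succ, Finset.sum_range_succ, mul_add]
      rw [sub_div] at hst hs ⊢
      linarith
  obtain ⟨h0, hs⟩ := key T le_rfl
  have hle : (z T ⬝ᵥ v i : ℝ) ^ 2 ≤ 1 := by
    rw [hzv, div_le_one (hpos T h0)]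
    have hcs := abs_real_inner_le_norm (v i) (w T)
    rw [hv.1 i, one_mul] at hcs
    have hin : (w T ⬝ᵥ v i : ℝ) = inner ℝ (v i) (w T) := by
      simp [PiLp.inner_apply, dotProduct]
    rw [hin, ← sq_abs]
    exact pow_le_pow_left₀ (abs_nonneg _) hcs 2
  have hlog := Real.log_nonpos (sq_nonneg _) hle
  have := div_nonpos_of_nonpos_of_nonneg hlog (by positivity : 0 ≤ 2 * μ)
  rw [sub_div] at hs
  linarith
end

section
/- Let A_1, …, A_T ∈ ℝ^{n×n} be symmetric matrices with ‖A_t‖₂ ≤ 1 for all t, let μ ∈ [0, 1/2], and run Oja's algorithm: w_1 a unit vector in ℝ^n, z_t = w_t/‖w_t‖₂, w_{t+1} = (I + μ A_t) w_t. Then ln(‖w_{T+1}‖₂²) ≤ μ Σ_{t=1}^T ( 2 z_tᵀ A_t z_t + μ z_tᵀ A_t² z_t ). -/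
open Matrix

/-- **Upper bound on the potential `‖w_{T+1}‖₂²` along Oja's algorithm.**
Indices are shifted so that `w 0` is the paper's `w_1`; in particular the paper's `w_{T+1}`
is `w T` here, and round `t ∈ {1,…,T}` corresponds to `t ∈ {0,…,T-1}`. -/
theorem oja_potential_upper (n T : ℕ) (μ : ℝ) (hμ0 : 0 ≤ μ) (hμ : μ ≤ 1 / 2)
    (A : ℕ → Matrix (Fin n) (Fin n) ℝ) (hA : ∀ t < T, (A t).IsSymm)
    (hAn : ∀ t < T, specNorm (A t) ≤ 1)
    (w : ℕ → EuclideanSpace ℝ (Fin n)) (hw1 : ‖w 0‖ = 1)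
    (hrec : ∀ t, w (t + 1) = (1 + μ • A t).mulVec (w t))
    (z : ℕ → EuclideanSpace ℝ (Fin n)) (hz : ∀ t, z t = ‖w t‖⁻¹ • w t) :
    Real.log (‖w T‖ ^ 2)
      ≤ μ * ∑ t ∈ Finset.range T,
          (2 * (z t ⬝ᵥ (A t).mulVec (z t)) + μ * (z t ⬝ᵥ (A t * A t).mulVec (z t))) := by
  have key : ∀ S, S ≤ T → w S ≠ 0 ∧ Real.log (‖w S‖ ^ 2)
      ≤ μ * ∑ t ∈ Finset.range S,
          (2 * (z t ⬝ᵥ (A t).mulVec (z t)) + μ * (z t ⬝ᵥ (A t * A t).mulVec (z t))) := by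
    intro S
    induction S with
    | zero =>
      intro _
      refine ⟨fun h => ?_, ?_⟩
      · rw [h] at hw1; simp at hw1
      · simp [hw1]
    | succ t ih =>
      intro hS
      have ht : t < T := hS
      obtain ⟨hne, hle⟩ := ih ht.le
      have hpos : 0 < ‖w t‖ := norm_pos_iff.mpr hne
      have hw : w (t + 1) = w t + μ • (Matrix.toEuclideanCLM (𝕜 := ℝ) (A t)) (w t) := by
        ext i
        have := congrFun (hrec t) i
        rw [this]
        simp [Matrix.add_mulVec, Matrix.smul_mulVec]
      have hb : ‖(Matrix.toEuclideanCLM (𝕜 := ℝ) (A t)) (w t)‖ ≤ ‖w t‖ := by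
        have h1 := (Matrix.toEuclideanCLM (𝕜 := ℝ) (A t)).le_opNorm (w t)
        have h2 : ‖Matrix.toEuclideanCLM (𝕜 := ℝ) (A t)‖ ≤ 1 := hAn t ht
        nlinarith
      have hne' : w (t + 1) ≠ 0 := by
        intro h0
        rw [h0] at hw
        have h3 : w t = -(μ • (Matrix.toEuclideanCLM (𝕜 := ℝ) (A t)) (w t)) :=
          eq_neg_of_add_eq_zero_left hw.symm
        have h4 := congrArg norm h3
        rw [norm_neg, norm_smul, Real.norm_of_nonneg hμ0] at h4
        nlinarith [norm_nonneg ((Matrix.toEuclideanCLM (𝕜 := ℝ) (A t)) (w t))]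
      refine ⟨hne', ?_⟩
      have hpos' : 0 < ‖w (t + 1)‖ := norm_pos_iff.mpr hne'
      have hnsq : ∀ v : EuclideanSpace ℝ (Fin n), ‖v‖ ^ 2 = v.ofLp ⬝ᵥ v.ofLp := by
        intro v
        rw [EuclideanSpace.real_norm_sq_eq]
        simp [dotProduct, sq]
      have hsymm : (w t).ofLp ⬝ᵥ (A t * A t).mulVec (w t).ofLp
          = (A t).mulVec (w t).ofLp ⬝ᵥ (A t).mulVec (w t).ofLp := by
        rw [← Matrix.mulVec_mulVec, Matrix.dotProduct_mulVec, ← Matrix.mulVec_transpose,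
          (hA t ht).eq]
      have hexp : ‖w (t + 1)‖ ^ 2 = ‖w t‖ ^ 2 + μ * (2 * ((w t).ofLp ⬝ᵥ (A t).mulVec (w t).ofLp)
          + μ * ((w t).ofLp ⬝ᵥ (A t * A t).mulVec (w t).ofLp)) := by
        rw [hnsq, hnsq, hrec t, hsymm, Matrix.add_mulVec, Matrix.smul_mulVec, Matrix.one_mulVec]
        simp only [add_dotProduct, dotProduct_add, smul_dotProduct, dotProduct_smul, smul_eq_mul]
        rw [dotProduct_comm ((A t).mulVec (w t).ofLp) (w t).ofLp]
        ring
      have hzt : (z t).ofLp = ‖w t‖⁻¹ • (w t).ofLp := by rw [hz t]; rfl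
      have hx : μ * (2 * (z t ⬝ᵥ (A t).mulVec (z t)) + μ * (z t ⬝ᵥ (A t * A t).mulVec (z t)))
          = ‖w (t + 1)‖ ^ 2 / ‖w t‖ ^ 2 - 1 := by
        rw [hexp, hzt]
        simp only [Matrix.mulVec_smul, smul_dotProduct, dotProduct_smul, smul_eq_mul]
        field_simp
        ring
      rw [Finset.sum_range_succ, mul_add, hx]
      have hlog := Real.log_le_sub_one_of_pos (x := ‖w (t + 1)‖ ^ 2 / ‖w t‖ ^ 2) (by positivity)
      rw [Real.log_div (by positivity) (by positivity)] at hlog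
      linarith
  exact (key T le_rfl).2
end

section
/- Let A_1, …, A_T ∈ ℝ^{n×n} be symmetric matrices with ‖A_t‖₂ ≤ 1 for all t that share a common unit eigenvector v ∈ ℝ^n, let μ ∈ [0, 1/2], and run Oja's algorithm: w_1 a unit vector in ℝ^n with vᵀ w_1 ≠ 0, z_t = w_t/‖w_t‖₂, w_{t+1} = (I + μ A_t) w_t. Then ln(‖w_{T+1}‖₂²) ≥ ln((vᵀ z_1)²) + 2μ Σ_{t=1}^T ( vᵀ A_t v − μ (vᵀ A_t v)² ). -/
open Matrix

lemma oja_log_aux (x : ℝ) (h1 : -(1/2) ≤ x) : x - x ^ 2 ≤ Real.log (1 + x) := by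
  rcases le_total 0 x with hx | hx
  · refine le_trans ?_ (Real.le_log_one_add_of_nonneg hx)
    rw [le_div_iff₀ (by linarith)]
    nlinarith [mul_nonneg hx hx, mul_nonneg (mul_nonneg hx hx) hx]
  · obtain ⟨y, rfl⟩ : ∃ y, x = -y := ⟨-x, by ring⟩
    have hy : 0 ≤ y := by linarith
    have hy2 : y ≤ 1/2 := by linarith
    rw [Real.le_log_iff_exp_le (by linarith)]
    have ha : 0 ≤ y + y ^ 2 := by positivity
    have hq := Real.quadratic_le_exp_of_nonneg ha
    have e : -y - (-y) ^ 2 = -(y + y ^ 2) := by ring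
    rw [e, Real.exp_neg, inv_le_iff_one_le_mul₀ (Real.exp_pos _)]
    have h3 : 0 ≤ 1 - y - y ^ 2 - y ^ 3 := by
      nlinarith [mul_nonneg hy hy, mul_nonneg hy (by linarith : (0:ℝ) ≤ 1/2 - y),
        mul_nonneg (mul_nonneg hy hy) (by linarith : (0:ℝ) ≤ 1/2 - y)]
    have h4 := mul_le_mul_of_nonneg_left hq (by linarith : 0 ≤ 1 + -y)
    have h5 : 0 ≤ y ^ 2 * (1 - y - y ^ 2 - y ^ 3) := by positivity
    nlinarith

/-- **Lower bound on the potential `‖w_{T+1}‖₂²` along Oja's algorithm,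
via a common unit eigenvector `v`.**  Indices are shifted so that `w 0` is the paper's `w_1`
(hence `z 0 = z_1 = w_1`) and `w T` is the paper's `w_{T+1}`. -/
theorem oja_potential_lower (n T : ℕ) (μ : ℝ) (hμ0 : 0 ≤ μ) (hμ : μ ≤ 1 / 2)
    (A : ℕ → Matrix (Fin n) (Fin n) ℝ) (hA : ∀ t < T, (A t).IsSymm)
    (hAn : ∀ t < T, specNorm (A t) ≤ 1)
    (v : EuclideanSpace ℝ (Fin n)) (hv : ‖v‖ = 1)
    (heig : ∀ t < T, ∃ lam : ℝ, (A t).mulVec v = lam • v)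
    (w : ℕ → EuclideanSpace ℝ (Fin n)) (hw1 : ‖w 0‖ = 1) (hinit : v ⬝ᵥ w 0 ≠ 0)
    (hrec : ∀ t, w (t + 1) = (1 + μ • A t).mulVec (w t))
    (z : ℕ → EuclideanSpace ℝ (Fin n)) (hz : ∀ t, z t = ‖w t‖⁻¹ • w t) :
    Real.log (‖w T‖ ^ 2)
      ≥ Real.log ((v ⬝ᵥ z 0) ^ 2)
        + 2 * μ * ∑ t ∈ Finset.range T,
            (v ⬝ᵥ (A t).mulVec v - μ * (v ⬝ᵥ (A t).mulVec v) ^ 2) := by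
  have hvv : v ⬝ᵥ v = 1 := by
    have h := EuclideanSpace.real_norm_sq_eq v
    rw [hv] at h
    simp only [dotProduct]
    rw [← one_pow 2, h]
    exact Finset.sum_congr rfl fun i _ => by ring
  have hcs : ∀ u : EuclideanSpace ℝ (Fin n), (v ⬝ᵥ u) ^ 2 ≤ ‖u‖ ^ 2 := by
    intro u
    have h := abs_real_inner_le_norm u v
    rw [EuclideanSpace.inner_eq_star_dotProduct, hv, mul_one] at h
    simp only [star_trivial] at h
    exact sq_le_sq.mpr (by rwa [abs_norm])
  have key : ∀ S ≤ T, v ⬝ᵥ w S ≠ 0 ∧ Real.log ((v ⬝ᵥ w S) ^ 2) ≥ Real.log ((v ⬝ᵥ z 0) ^ 2)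
        + 2 * μ * ∑ t ∈ Finset.range S,
            (v ⬝ᵥ (A t).mulVec v - μ * (v ⬝ᵥ (A t).mulVec v) ^ 2) := by
    intro S
    induction S with
    | zero =>
      intro _
      refine ⟨hinit, ?_⟩
      have : z 0 = w 0 := by rw [hz, hw1]; simp
      rw [this]; simp
    | succ S ih =>
      intro hS
      obtain ⟨hne, hlog⟩ := ih (by omega)
      obtain ⟨lam, hl⟩ := heig S (by omega)
      have hvA : v ⬝ᵥ (A S).mulVec v = lam := by
        rw [hl]
        simp [hvv]
      have hlam : |lam| ≤ 1 := by
        have h := (Matrix.toEuclideanCLM (𝕜 := ℝ) (A S)).le_opNorm v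
        have h2 := hAn S (by omega)
        have h3 : Matrix.toEuclideanCLM (𝕜 := ℝ) (A S) v = lam • v := by
          ext i
          have := congrFun hl i
          simpa using this
        rw [h3, norm_smul, hv, Real.norm_eq_abs] at h
        unfold specNorm at h2
        linarith
      have hstep : v ⬝ᵥ w (S + 1) = (1 + μ * lam) * (v ⬝ᵥ w S) := by
        rw [hrec S, Matrix.add_mulVec, Matrix.one_mulVec, Matrix.smul_mulVec, dotProduct_add,
          dotProduct_smul, Matrix.dotProduct_mulVec, ← Matrix.mulVec_transpose,
          (hA S (by omega)).eq, hl]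
        simp
        ring
      have hml := abs_le.mp hlam
      have hb : -(1/2) ≤ μ * lam := by nlinarith
      have hpos : 0 < 1 + μ * lam := by linarith
      refine ⟨by rw [hstep]; exact mul_ne_zero hpos.ne' hne, ?_⟩
      have hx := oja_log_aux _ hb
      rw [hstep, mul_pow, Real.log_mul (by positivity) (by positivity), Finset.sum_range_succ,
        hvA, Real.log_pow]
      push_cast
      linarith
  obtain ⟨hne, h⟩ := key T le_rfl
  exact le_trans h (Real.log_le_log (by positivity) (hcs _))
end

section
/- Let A_1, …, A_m ∈ ℝ^{n×n} be symmetric matrices with max_{i∈[m]} ‖A_i‖₂ ≤ 1 that share a full set of common orthonormal eigenvectors v_1, …, v_n, let 𝒜(x) = (xᵀA_1x, …, xᵀA_mx), let g : ℝ^m → ℝ be convex, and let G > 0 satisfy G ≥ ‖Σ_{i=1}^m g'(i) A_i‖₂ for every y ∈ [-1,1]^m and every subgradient g' ∈ ∂g(y). Run the coupled Oja/subgradient iteration with step size μ ∈ (0, 1/2]: w_1 a unit vector in ℝ^n with v_jᵀ w_1 ≠ 0 for all j ∈ [n]; for each t, z_t = w_t/‖w_t‖₂, g_t is some subgradient in ∂g(𝒜(z_t)),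 G_t = −(1/G) Σ_{i=1}^m g_t(i) A_i, and w_{t+1} = (I + μ G_t) w_t. Then, with F(X) := g(Tr(XA_1), …, Tr(XA_m)) and X* any minimizer of F over {X ∈ ℝ^{n×n} symmetric : X ⪰ 0, Tr(X) = 1}: (1/T) Σ_{t=1}^T F(z_t z_tᵀ) − F(X*) ≤ 3μG/2 − G · min_{j∈[n]} ln((z_1ᵀ v_j)²)/(2μT). -/
open Matrix

/-- `s` is a subgradient of `g` at `y`, i.e. `s ∈ ∂g(y)`:
`g x ≥ g y + ⟨s, x - y⟩` for all `x`. -/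
def IsSubgradientAt {m : ℕ} (g : (Fin m → ℝ) → ℝ) (y s : Fin m → ℝ) : Prop :=
  ∀ x : Fin m → ℝ, g y + s ⬝ᵥ (x - y) ≤ g x

lemma aux_log {x : ℝ} (h : |x| ≤ 1/2) : x - x^2 ≤ Real.log (1 + x) := by
  obtain ⟨h1, h2⟩ := abs_le.mp h
  have hp : 0 < 1 + x := by linarith
  rw [Real.le_log_iff_exp_le hp]
  have key : Real.exp (-(x - x^2)) ≥ 0 := (Real.exp_pos _).le
  have h3 : |x - x^2| ≤ 1 := by rw [abs_le]; constructor <;> nlinarith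
  have h4 := Real.abs_exp_sub_one_sub_id_le h3
  have h5 := (abs_le.mp h4).2
  by_cases hx : x ^ 2 * (1 - x)^2 ≤ x^2
  · nlinarith
  · -- negative x : use exp (-s) ≥ 1 - s + ...
    have hxneg : x < 0 := by
      by_contra hc
      push Not at hc
      apply hx
      nlinarith [sq_nonneg x, mul_nonneg (sq_nonneg x) hc]
    set s := -(x - x^2) with hs
    have hs0 : 0 ≤ s := by rw [hs]; nlinarith
    have hq := Real.quadratic_le_exp_of_nonneg hs0
    have he : Real.exp (x - x^2) = (Real.exp s)⁻¹ := by
      rw [← Real.exp_neg, hs, neg_neg]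
    rw [he, inv_le_comm₀ (Real.exp_pos _) hp]
    refine le_trans ?_ hq
    rw [inv_le_iff_one_le_mul₀ hp]
    have : s = -x + x^2 := by rw [hs]; ring
    rw [this]
    nlinarith [mul_nonneg (sq_nonneg x) (by linarith : (0:ℝ) ≤ 1/2 + x), mul_nonneg (mul_nonneg (sq_nonneg x) (by linarith : (0:ℝ) ≤ -x)) (by linarith : (0:ℝ) ≤ 1/2 + x), sq_nonneg x, sq_nonneg (x^2), mul_nonneg (sq_nonneg (x^2)) (by linarith : (0:ℝ) ≤ 1/2 + x)]

lemma aux_core {n T : ℕ} (μ : ℝ) (hμ0 : 0 < μ) (hμ : μ ≤ 1/2) (c d p : ℕ → Fin n → ℝ)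
    (hc : ∀ t j, c (t+1) j = (1 + μ * d t j) * c t j) (hc0 : ∀ j, c 0 j ≠ 0)
    (hd : ∀ t < T, ∀ j, |d t j| ≤ 1)
    (hp : ∀ t j, p t j = c t j ^ 2 / ∑ k, c t k ^ 2) (j : Fin n) :
    2 * μ * ∑ t ∈ Finset.range T, (d t j - ∑ k, p t k * d t k) ≤
      3 * μ^2 * T - Real.log (p 0 j) := by
  have habs : ∀ t < T, ∀ j, |μ * d t j| ≤ 1/2 := by
    intro t ht j
    rw [abs_mul, abs_of_pos hμ0]
    nlinarith [hd t ht j, abs_nonneg (d t j)]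
  have hne : ∀ t ≤ T, ∀ j, c t j ≠ 0 := by
    intro t
    induction t with
    | zero => intro _; exact hc0
    | succ t ih =>
      intro ht j
      rw [hc]
      have := (abs_le.mp (habs t (by omega) j)).1
      exact mul_ne_zero (by linarith) (ih (by omega) j)
  have hS : ∀ t ≤ T, 0 < ∑ k, c t k ^ 2 := fun t ht =>
    Finset.sum_pos (fun k _ => by have := hne t ht k; positivity) ⟨j, Finset.mem_univ _⟩
  have hpp : ∀ t ≤ T, 0 < p t j := fun t ht => by
    rw [hp]; have := hS t ht; have := hne t ht j; positivity
  have hps : ∀ t ≤ T, ∑ k, p t k = 1 := fun t ht => by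
    simp_rw [hp, ← Finset.sum_div]; exact div_self (hS t ht).ne'
  have hp0 : ∀ t ≤ T, ∀ k, 0 ≤ p t k := fun t ht k => by
    rw [hp]; have := hS t ht; positivity
  have step : ∀ t < T, 2 * μ * (d t j - ∑ k, p t k * d t k) ≤
      3 * μ^2 + (Real.log (p (t+1) j) - Real.log (p t j)) := by
    intro t ht
    set R := ∑ k, p t k * (1 + μ * d t k)^2 with hR
    have hSR : ∑ k, c (t+1) k ^ 2 = R * ∑ k, c t k ^ 2 := by
      rw [hR, Finset.sum_mul]
      refine Finset.sum_congr rfl fun k _ => ?_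
      rw [hc, hp]
      have := (hS t ht.le).ne'
      field_simp
    have hRpos : 0 < R := by
      have h1 := hS (t+1) ht
      rw [hSR] at h1
      exact pos_of_mul_pos_left h1 (hS t ht.le).le
    have hRle : R ≤ 1 + (2 * μ * ∑ k, p t k * d t k + μ^2) := by
      rw [hR]
      have hone : (1:ℝ) + (2 * μ * ∑ k, p t k * d t k + μ^2) = ∑ k, p t k + (2 * μ * ∑ k, p t k * d t k + μ^2) := by rw [hps t ht.le]
      rw [hone]
      have : μ^2 = ∑ k, p t k * μ^2 := by rw [← Finset.sum_mul, hps t ht.le, one_mul]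
      rw [this, Finset.mul_sum, ← Finset.sum_add_distrib, ← Finset.sum_add_distrib]
      refine Finset.sum_le_sum fun k _ => ?_
      have h1 : d t k ^ 2 ≤ 1 := (sq_le_one_iff_abs_le_one _).mpr (hd t ht k)
      have h2 : 0 ≤ p t k * (μ^2 * (1 - d t k ^2)) :=
        mul_nonneg (hp0 t ht.le k) (mul_nonneg (sq_nonneg _) (by linarith))
      nlinarith
    have hlogR : Real.log R ≤ 2 * μ * ∑ k, p t k * d t k + μ^2 := by
      have := Real.log_le_sub_one_of_pos hRpos
      linarith
    have hx := habs t ht j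
    have hx1 : 0 < 1 + μ * d t j := by linarith [(abs_le.mp hx).1]
    have hpn : p (t+1) j = (1 + μ * d t j)^2 * p t j / R := by
      rw [hp, hp, hSR, hc]
      have := (hS t ht.le).ne'
      field_simp
    have hl : Real.log (p (t+1) j) = 2 * Real.log (1 + μ * d t j) + Real.log (p t j) - Real.log R := by
      rw [hpn, Real.log_div (mul_pos (by positivity) (hpp t ht.le)).ne' hRpos.ne',
        Real.log_mul (by positivity) (hpp t ht.le).ne', Real.log_pow]
      norm_num
    have h1 : d t j ^ 2 ≤ 1 := (sq_le_one_iff_abs_le_one _).mpr (hd t ht j)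
    have := aux_log hx
    nlinarith [mul_nonneg (sq_nonneg μ) (sub_nonneg.mpr h1)]
  have hsum := Finset.sum_le_sum (fun t (ht : t ∈ Finset.range T) => step t (Finset.mem_range.mp ht))
  rw [← Finset.mul_sum, Finset.sum_add_distrib, Finset.sum_range_sub (fun t => Real.log (p t j))] at hsum
  have hlast : Real.log (p T j) ≤ 0 := Real.log_nonpos (hp0 T le_rfl j) (by
    rw [← hps T le_rfl]
    exact Finset.single_le_sum (fun k _ => hp0 T le_rfl k) (Finset.mem_univ j))
  simp only [Finset.sum_const, Finset.card_range, nsmul_eq_mul] at hsum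
  linarith

lemma aux_eig {n : ℕ} (M : Matrix (Fin n) (Fin n) ℝ) (x : EuclideanSpace ℝ (Fin n)) (l : ℝ)
    (hx : ‖x‖ = 1) (h : M.mulVec x = l • x) : |l| ≤ specNorm M := by
  have h1 := (Matrix.toEuclideanCLM (𝕜 := ℝ) M).le_opNorm x
  have h2 : Matrix.toEuclideanCLM (𝕜 := ℝ) M x = l • x := by
    ext i
    have := congrFun h i
    simpa [Matrix.ofLp_toEuclideanCLM] using this
  rw [h2, norm_smul, hx, mul_one, mul_one, Real.norm_eq_abs] at h1
  exact h1

lemma aux_trace {n : ℕ} (v : Fin n → EuclideanSpace ℝ (Fin n)) (hv : Orthonormal ℝ v)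
    (X A : Matrix (Fin n) (Fin n) ℝ) (l : Fin n → ℝ)
    (h : ∀ j, A.mulVec (v j) = l j • v j) :
    (X * A).trace = ∑ j, (v j ⬝ᵥ X.mulVec (v j)) * l j := by
  set V : Matrix (Fin n) (Fin n) ℝ := Matrix.of fun i j => v j i with hV
  have hVV : Vᵀ * V = 1 := by
    ext i j
    have := (orthonormal_iff_ite.mp hv) j i
    rw [EuclideanSpace.inner_eq_star_dotProduct] at this
    simp only [star_trivial] at this
    rw [Matrix.one_apply, Matrix.mul_apply]
    simp only [eq_comm (a := i)]
    rw [← this]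
    simp [dotProduct, hV]
  have hVV' : V * Vᵀ = 1 := mul_eq_one_comm.mp hVV
  have h1 : (X * A).trace = (Vᵀ * (X * (A * V))).trace := by
    rw [Matrix.trace_mul_comm Vᵀ, Matrix.mul_assoc, Matrix.mul_assoc, hVV', Matrix.mul_one]
  have h2 : A * V = V * Matrix.diagonal l := by
    ext i j
    have := congrFun (h j) i
    rw [Matrix.mul_diagonal, Matrix.mul_apply]
    simpa [Matrix.mulVec, dotProduct, hV, mul_comm] using this
  rw [h1, h2, ← Matrix.mul_assoc, ← Matrix.mul_assoc, Matrix.trace]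
  refine Finset.sum_congr rfl fun j _ => ?_
  rw [Matrix.diag_apply, Matrix.mul_diagonal, Matrix.mul_assoc, Matrix.mul_apply]
  congr 1

/-- **Convergence of the coupled Oja/subgradient iteration (Algorithm 3, Theorem 4, main
estimate).**  The symmetric matrices `A i` have spectral norm at most `1` and share the full
set of common orthonormal eigenvectors `v j` (with eigenvalues `lam i j`), `g` is convex with
the spectral-norm Lipschitz bound `G` on subgradient combinations over `[-1,1]^m`, and the
iteration is `z t = w t / ‖w t‖₂`, `gt t ∈ ∂g(𝒜(z t))`, `Gm t = -(1/G) ∑ i gt t i • A i`,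
`w (t+1) = (I + μ Gm t) w t`, started at a unit vector `w 0` with `v jᵀ w 0 ≠ 0` for all `j`.
With `F X = g(Tr(X A 1), …, Tr(X A m))` and `X*` any minimizer of `F` over the set of
positive semidefinite unit-trace matrices,
`(1/T) ∑_t F(z_t z_tᵀ) - F(X*) ≤ 3μG/2 - G ⋅ min_j ln((z_1ᵀ v_j)²)/(2μT)`.
Indices are shifted so that round `t ∈ {1,…,T}` of the paper is `t ∈ {0,…,T-1}` here,
`w 0 = w_1` and `z 0 = z_1`. -/
theorem oja_subgradient_regret (n m T : ℕ) (hT : 1 ≤ T)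
    (μ : ℝ) (hμ0 : 0 < μ) (hμ : μ ≤ 1 / 2)
    (A : Fin m → Matrix (Fin n) (Fin n) ℝ) (hA : ∀ i, (A i).IsSymm)
    (hAn : ∀ i, specNorm (A i) ≤ 1)
    (v : Fin n → EuclideanSpace ℝ (Fin n)) (hv : Orthonormal ℝ v)
    (lam : Fin m → Fin n → ℝ) (heig : ∀ i j, (A i).mulVec (v j) = lam i j • v j)
    (g : (Fin m → ℝ) → ℝ) (hg : ConvexOn ℝ Set.univ g)
    (G : ℝ) (hG0 : 0 < G)
    (hG : ∀ y : Fin m → ℝ, (∀ i, |y i| ≤ 1) →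
      ∀ s : Fin m → ℝ, IsSubgradientAt g y s → specNorm (∑ i, s i • A i) ≤ G)
    (w : ℕ → EuclideanSpace ℝ (Fin n)) (hw1 : ‖w 0‖ = 1)
    (hinit : ∀ j, v j ⬝ᵥ w 0 ≠ 0)
    (z : ℕ → EuclideanSpace ℝ (Fin n)) (hz : ∀ t, z t = ‖w t‖⁻¹ • w t)
    (gt : ℕ → Fin m → ℝ)
    (hgt : ∀ t < T, IsSubgradientAt g (fun i => z t ⬝ᵥ (A i).mulVec (z t)) (gt t))
    (Gm : ℕ → Matrix (Fin n) (Fin n) ℝ)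
    (hGm : ∀ t, Gm t = (-(1 / G)) • ∑ i, gt t i • A i)
    (hrec : ∀ t, w (t + 1) = (1 + μ • Gm t).mulVec (w t))
    (F : Matrix (Fin n) (Fin n) ℝ → ℝ) (hF : ∀ X, F X = g (fun i => (X * A i).trace))
    (Xs : Matrix (Fin n) (Fin n) ℝ) (hXsfeas : Xs.PosSemidef ∧ Xs.trace = 1)
    (hXsopt : ∀ Y : Matrix (Fin n) (Fin n) ℝ, Y.PosSemidef → Y.trace = 1 → F Xs ≤ F Y) :
    (1 / T : ℝ) * ∑ t ∈ Finset.range T, F (vecMulVec (z t) (z t)) - F Xs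
      ≤ 3 * μ * G / 2
        - G * (⨅ j : Fin n, Real.log ((z 0 ⬝ᵥ v j) ^ 2)) / (2 * μ * T) := by
  have hpsd := hXsfeas.1
  have hvn : ∀ j, ‖v j‖ = 1 := hv.1
  -- eigenvalues of combinations
  have hBeig : ∀ t j, (∑ i, gt t i • A i).mulVec (v j) = (∑ i, gt t i * lam i j) • v j := by
    intro t j
    rw [Matrix.sum_mulVec, Finset.sum_smul]
    refine Finset.sum_congr rfl fun i _ => ?_
    rw [Matrix.smul_mulVec, heig, smul_smul]
  set d : ℕ → Fin n → ℝ := fun t j => -(1 / G) * ∑ i, gt t i * lam i j with hd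
  set c : ℕ → Fin n → ℝ := fun t j => v j ⬝ᵥ w t with hc
  set p : ℕ → Fin n → ℝ := fun t j => (z t ⬝ᵥ v j) ^ 2 with hp
  set q : Fin n → ℝ := fun j => v j ⬝ᵥ Xs.mulVec (v j) with hq
  have hlam : ∀ i j, |lam i j| ≤ 1 := fun i j =>
    (aux_eig _ _ _ (hvn j) (heig i j)).trans (hAn i)
  -- traces
  have hvv : ∀ (x : EuclideanSpace ℝ (Fin n)) j,
      v j ⬝ᵥ (vecMulVec x x).mulVec (v j) = (x ⬝ᵥ v j) ^ 2 := by
    intro x j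
    rw [Matrix.vecMulVec_mulVec, dotProduct_comm (v j).ofLp]
    simp [dotProduct_comm, sq]
  have hnorm : ∀ x : EuclideanSpace ℝ (Fin n), ‖x‖ ^ 2 = ∑ j, (x ⬝ᵥ v j) ^ 2 := by
    intro x
    have h1 := aux_trace v hv (vecMulVec x x) 1 (fun _ => 1) (by intro j; simp)
    simp only [hvv, mul_one] at h1
    rw [← h1, EuclideanSpace.real_norm_sq_eq]
    simp [Matrix.trace, vecMulVec_apply, sq]
  have hyt : ∀ t i, (vecMulVec (z t) (z t) * A i).trace = ∑ j, p t j * lam i j := by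
    intro t i
    rw [aux_trace v hv _ (A i) (lam i) (fun j => by rw [heig])]
    simp only [hvv, hp]
  have hys : ∀ i, (Xs * A i).trace = ∑ j, q j * lam i j := fun i =>
    aux_trace v hv _ (A i) (lam i) (fun j => by rw [heig])
  have hyt2 : ∀ t i, z t ⬝ᵥ (A i).mulVec (z t) = (vecMulVec (z t) (z t) * A i).trace := by
    intro t i
    rw [Matrix.trace_mul_comm, Matrix.mul_vecMulVec, Matrix.trace_vecMulVec, dotProduct_comm]
  have hq0 : ∀ j, 0 ≤ q j := by
    intro j
    have := hpsd.dotProduct_mulVec_nonneg (v j).ofLp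
    simpa using this
  have hq1 : ∑ j, q j = 1 := by
    have h1 := aux_trace v hv Xs 1 (fun _ => 1) (by intro j; simp)
    simp only [mul_one] at h1
    rw [← h1, hXsfeas.2]
  -- recursion
  have hVG : ∀ t j, (Gm t).mulVec (v j) = d t j • v j := by
    intro t j
    rw [hGm, Matrix.smul_mulVec, hBeig, smul_smul]
  have hsymm : ∀ t, (Gm t)ᵀ = Gm t := by
    intro t
    rw [hGm, Matrix.transpose_smul, Matrix.transpose_sum]
    congr 1
    refine Finset.sum_congr rfl fun i _ => ?_
    rw [Matrix.transpose_smul, (hA i).eq]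
  have hcrec : ∀ t j, c (t+1) j = (1 + μ * d t j) * c t j := by
    intro t j
    simp only [hc]
    rw [hrec, Matrix.add_mulVec, Matrix.one_mulVec, Matrix.smul_mulVec, dotProduct_add,
      dotProduct_smul, Matrix.dotProduct_mulVec, ← Matrix.mulVec_transpose, hsymm, hVG,
      smul_dotProduct]
    simp only [smul_eq_mul]
    ring
  have hpc : ∀ t j, p t j = c t j ^ 2 / ∑ k, c t k ^ 2 := by
    intro t j
    have h1 : ∑ k, c t k ^ 2 = ‖w t‖ ^ 2 := by
      rw [hnorm]
      refine Finset.sum_congr rfl fun k _ => ?_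
      simp only [hc]
      rw [dotProduct_comm]
    rw [h1]
    simp only [hp, hc]
    rw [hz, WithLp.ofLp_smul, smul_dotProduct, dotProduct_comm, smul_eq_mul, mul_pow, inv_pow,
      div_eq_inv_mul]
  have hp0 : ∀ t j, 0 ≤ p t j := fun t j => sq_nonneg _
  have hp1 : ∀ t, ∑ j, p t j ≤ 1 := by
    intro t
    simp_rw [hpc, ← Finset.sum_div]
    exact div_self_le_one _
  have hdle : ∀ t < T, ∀ j, |d t j| ≤ 1 := by
    intro t ht j
    have h1 := hG _ (fun i => by
      rw [hyt2, hyt]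
      calc |∑ j, p t j * lam i j| ≤ ∑ j, |p t j * lam i j| := Finset.abs_sum_le_sum_abs _ _
        _ ≤ ∑ j, p t j := Finset.sum_le_sum fun k _ => by
            rw [abs_mul, abs_of_nonneg (hp0 t k)]
            exact mul_le_of_le_one_right (hp0 t k) (hlam i k)
        _ ≤ 1 := hp1 t) _ (hgt t ht)
    have h2 := (aux_eig _ _ _ (hvn j) (hBeig t j)).trans h1
    simp only [hd]
    rw [abs_mul, abs_neg, abs_of_pos (by positivity : 0 < 1 / G), one_div, inv_mul_le_iff₀ hG0,
      mul_one]
    exact h2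
  have hcore := aux_core μ hμ0 hμ c d p hcrec hinit hdle hpc
  -- per step regret
  have hstep : ∀ t < T, F (vecMulVec (z t) (z t)) - F Xs ≤
      G * ∑ j, q j * (d t j - ∑ k, p t k * d t k) := by
    intro t ht
    have h1 := hgt t ht (fun i => (Xs * A i).trace)
    simp only [hyt2] at h1
    rw [hF, hF]
    have h2 : gt t ⬝ᵥ ((fun i => (Xs * A i).trace) - fun i => (vecMulVec (z t) (z t) * A i).trace)
        = - (G * ∑ j, q j * (d t j - ∑ k, p t k * d t k)) := by
      have h3 : ∑ j, q j * (d t j - ∑ k, p t k * d t k) = ∑ j, (q j - p t j) * d t j := by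
        simp_rw [mul_sub, sub_mul, Finset.sum_sub_distrib, ← Finset.sum_mul, hq1, one_mul]
      rw [h3]
      simp only [dotProduct, Pi.sub_apply, hys, hyt, hd, ← Finset.sum_sub_distrib, Finset.mul_sum,
        ← Finset.sum_neg_distrib]
      rw [Finset.sum_comm]
      refine Finset.sum_congr rfl fun j _ => Finset.sum_congr rfl fun i _ => ?_
      field_simp
    rw [h2] at h1
    linarith
  set L := ⨅ j : Fin n, Real.log ((z 0 ⬝ᵥ v j) ^ 2) with hL
  have hTpos : (0:ℝ) < T := by exact_mod_cast hT
  have hsumle : ∑ t ∈ Finset.range T, F (vecMulVec (z t) (z t)) - T * F Xs ≤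
      G * ∑ j, q j * ∑ t ∈ Finset.range T, (d t j - ∑ k, p t k * d t k) := by
    have h1 := Finset.sum_le_sum
      (fun t (ht : t ∈ Finset.range T) => hstep t (Finset.mem_range.mp ht))
    rw [← Finset.mul_sum, Finset.sum_comm, Finset.sum_sub_distrib] at h1
    simp only [← Finset.mul_sum, Finset.sum_const, Finset.card_range, nsmul_eq_mul] at h1
    exact h1
  have hj : ∀ j, ∑ t ∈ Finset.range T, (d t j - ∑ k, p t k * d t k) ≤
      (3 * μ^2 * T - L) / (2 * μ) := by
    intro j
    rw [le_div_iff₀ (by positivity)]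
    have h1 := hcore j
    have h2 : L ≤ Real.log (p 0 j) := ciInf_le (Set.finite_range _).bddBelow j
    linarith
  have hq2 : ∑ j, q j * ∑ t ∈ Finset.range T, (d t j - ∑ k, p t k * d t k) ≤
      (3 * μ^2 * T - L) / (2 * μ) := by
    calc _ ≤ ∑ j, q j * ((3 * μ^2 * T - L) / (2 * μ)) :=
          Finset.sum_le_sum fun j _ => mul_le_mul_of_nonneg_left (hj j) (hq0 j)
      _ = _ := by rw [← Finset.sum_mul, hq1, one_mul]
  have hfin := hsumle.trans (mul_le_mul_of_nonneg_left hq2 hG0.le)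
  have e1 : (1 / T : ℝ) * ∑ t ∈ Finset.range T, F (vecMulVec (z t) (z t)) - F Xs
      = (1 / T : ℝ) * (∑ t ∈ Finset.range T, F (vecMulVec (z t) (z t)) - T * F Xs) := by
    field_simp
  have e2 : 3 * μ * G / 2 - G * L / (2 * μ * T)
      = (1 / T : ℝ) * (G * ((3 * μ^2 * T - L) / (2 * μ))) := by
    field_simp
  rw [e1, e2]
  exact mul_le_mul_of_nonneg_left hfin (by positivity)
end

section
/- Let A_1, …, A_m ∈ ℝ^{n×n} be symmetric matrices that share a full set of common orthonormal eigenvectors, let 𝒜(x) = (xᵀA_1x, …, xᵀA_mx) for x ∈ ℝ^n and 𝒜(X) = (Tr(XA_1), …, Tr(XA_m)) for symmetric X ∈ ℝ^{n×n}, and let g : ℝ^m → ℝ be convex. Then the semidefinite relaxation is tight: min_{x∈ℝ^n : ‖x‖₂=1} g(𝒜(x)) = min_{X symmetric, X⪰0, Tr(X)=1} g(𝒜(X)). In particular, the relaxation admits a rank-one optimal solution. -/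
open Matrix

theorem sdp_key {n m : ℕ}
    (A : Fin m → Matrix (Fin n) (Fin n) ℝ)
    (v : Fin n → EuclideanSpace ℝ (Fin n)) (hv : Orthonormal ℝ v)
    (lam : Fin m → Fin n → ℝ) (heig : ∀ i j, (A i).mulVec (v j) = lam i j • v j)
    (X : Matrix (Fin n) (Fin n) ℝ) (hX : X.PosSemidef) (hT : X.trace = 1) :
    ∃ x : EuclideanSpace ℝ (Fin n), ‖x‖ = 1 ∧
      (fun i => x ⬝ᵥ (A i).mulVec x) = fun i => (X * A i).trace := by
  let V : Matrix (Fin n) (Fin n) ℝ := Matrix.of fun a j => v j a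
  have hVV : Vᵀ * V = 1 := by
    ext j k
    have h := (orthonormal_iff_ite.mp hv) j k
    rw [PiLp.inner_apply] at h
    rw [Matrix.one_apply, ← h, Matrix.mul_apply]
    simp [V, mul_comm]
  have hVV' : V * Vᵀ = 1 := mul_eq_one_comm.mp hVV
  have hAV : ∀ i, A i * V = V * diagonal (lam i) := by
    intro i
    ext a j
    have h := congrFun (heig i j) a
    rw [Matrix.mul_diagonal]
    simp only [Matrix.mulVec, dotProduct] at h
    simp only [Matrix.mul_apply, V, Matrix.of_apply]
    rw [h]
    simp [mul_comm]
  have hD : ∀ i, Vᵀ * A i * V = diagonal (lam i) := by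
    intro i
    rw [Matrix.mul_assoc, hAV, ← Matrix.mul_assoc, hVV, Matrix.one_mul]
  have hW : (Vᵀ * X * V).PosSemidef := by
    have := hX.conjTranspose_mul_mul_same V
    simpa [Matrix.conjTranspose_eq_transpose_of_trivial] using this
  have hw : ∀ j, 0 ≤ (Vᵀ * X * V) j j := fun j => hW.diag_nonneg
  let s : Fin n → ℝ := fun j => √((Vᵀ * X * V) j j)
  have hs : ∀ j, s j * s j = (Vᵀ * X * V) j j := fun j => Real.mul_self_sqrt (hw j)
  have hquad : ∀ M : Matrix (Fin n) (Fin n) ℝ,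
      (V *ᵥ s) ⬝ᵥ (M *ᵥ (V *ᵥ s)) = s ⬝ᵥ ((Vᵀ * M * V) *ᵥ s) := by
    intro M
    rw [Matrix.mulVec_mulVec, Matrix.mul_assoc, ← Matrix.mulVec_mulVec s Vᵀ,
      Matrix.dotProduct_mulVec s, Matrix.vecMul_transpose]
  have htr : ∀ M : Matrix (Fin n) (Fin n) ℝ, (X * M).trace
      = ((Vᵀ * X * V) * (Vᵀ * M * V)).trace := by
    intro M
    have : (Vᵀ * X * V) * (Vᵀ * M * V) = Vᵀ * (X * ((V * Vᵀ) * (M * V))) := by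
      simp only [Matrix.mul_assoc]
    rw [this, hVV', Matrix.one_mul, Matrix.trace_mul_comm Vᵀ, Matrix.mul_assoc, Matrix.mul_assoc,
      hVV', Matrix.mul_one]
  have hdiag : ∀ d : Fin n → ℝ, s ⬝ᵥ (diagonal d *ᵥ s)
      = ((Vᵀ * X * V) * diagonal d).trace := by
    intro d
    simp only [dotProduct, Matrix.mulVec_diagonal, Matrix.trace, Matrix.diag_apply,
      Matrix.mul_diagonal]
    refine Finset.sum_congr rfl fun j _ => ?_
    rw [← hs]; ring
  refine ⟨WithLp.toLp 2 (V *ᵥ s), ?_, ?_⟩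
  · have h1 : (V *ᵥ s) ⬝ᵥ (V *ᵥ s) = 1 := by
      have h := hquad 1
      rw [Matrix.one_mulVec, Matrix.mul_one, hVV] at h
      rw [h, ← Matrix.diagonal_one, hdiag, Matrix.diagonal_one]
      have h2 := htr 1
      rw [Matrix.mul_one, Matrix.mul_one Vᵀ, hVV, hT] at h2
      exact h2.symm
    rw [EuclideanSpace.norm_eq, Real.sqrt_eq_one, ← h1]
    simp [dotProduct, sq]
  · funext i
    change (V *ᵥ s) ⬝ᵥ (A i *ᵥ (V *ᵥ s)) = _
    rw [hquad, hD, hdiag, htr, hD]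

theorem sdp_rank_one {n : ℕ} (x : EuclideanSpace ℝ (Fin n)) (M : Matrix (Fin n) (Fin n) ℝ) :
    ((vecMulVec x x : Matrix (Fin n) (Fin n) ℝ) * M).trace = x ⬝ᵥ M.mulVec x := by
  rw [Matrix.vecMulVec_mul, Matrix.trace_vecMulVec, dotProduct_comm,
    Matrix.dotProduct_mulVec]

/-- **Tightness of the semidefinite relaxation (Remark after Theorem 4).**
If the symmetric matrices `A i` share a full set of common orthonormal eigenvectors, and
`g` is convex, then minimizing `g(𝒜 x)` (with `𝒜 x = (xᵀA_ix)_i`) over the unit sphere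
equals minimizing `g(Tr(X A 1), …, Tr(X A m))` over positive semidefinite unit-trace
matrices; in particular the relaxation admits a rank-one optimal solution `x xᵀ` with
`‖x‖₂ = 1`. -/
theorem sdp_relaxation_tight (n m : ℕ) (hn : 0 < n)
    (A : Fin m → Matrix (Fin n) (Fin n) ℝ) (hA : ∀ i, (A i).IsSymm)
    (v : Fin n → EuclideanSpace ℝ (Fin n)) (hv : Orthonormal ℝ v)
    (lam : Fin m → Fin n → ℝ) (heig : ∀ i j, (A i).mulVec (v j) = lam i j • v j)
    (g : (Fin m → ℝ) → ℝ) (hg : ConvexOn ℝ Set.univ g) :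
    sInf ((fun x : EuclideanSpace ℝ (Fin n) =>
        g (fun i => x ⬝ᵥ (A i).mulVec x)) '' {x | ‖x‖ = 1})
      = sInf ((fun X : Matrix (Fin n) (Fin n) ℝ =>
          g (fun i => (X * A i).trace)) '' {X | X.PosSemidef ∧ X.trace = 1}) ∧
    ∃ x : EuclideanSpace ℝ (Fin n), ‖x‖ = 1 ∧
      ∀ Y : Matrix (Fin n) (Fin n) ℝ, Y.PosSemidef → Y.trace = 1 →
        g (fun i => ((vecMulVec x x : Matrix (Fin n) (Fin n) ℝ) * A i).trace)
          ≤ g (fun i => (Y * A i).trace) := by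
  have hfeas : ∀ x : EuclideanSpace ℝ (Fin n), ‖x‖ = 1 →
      (vecMulVec x x : Matrix (Fin n) (Fin n) ℝ).PosSemidef ∧
      (vecMulVec x x : Matrix (Fin n) (Fin n) ℝ).trace = 1 := by
    intro x hx
    refine ⟨?_, ?_⟩
    · simpa using Matrix.posSemidef_vecMulVec_self_star (x : Fin n → ℝ)
    · rw [Matrix.trace_vecMulVec]
      rw [EuclideanSpace.norm_eq, Real.sqrt_eq_one] at hx
      rw [← hx]
      simp [dotProduct, sq]
  refine ⟨?_, ?_⟩
  · congr 1
    ext y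
    constructor
    · rintro ⟨x, hx, rfl⟩
      refine ⟨vecMulVec x x, hfeas x hx, ?_⟩
      simp only [sdp_rank_one]
    · rintro ⟨X, ⟨hX, hT⟩, rfl⟩
      obtain ⟨x, hx, h⟩ := sdp_key A v hv lam heig X hX hT
      exact ⟨x, hx, congrArg g h⟩
  · have hgc : Continuous g := by
      rw [← continuousOn_univ]
      exact hg.continuousOn isOpen_univ
    have hc : Continuous (fun x : EuclideanSpace ℝ (Fin n) =>
        g (fun i => x ⬝ᵥ (A i).mulVec x)) := by
      refine hgc.comp (continuous_pi fun i => ?_)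
      simp only [dotProduct, Matrix.mulVec]
      fun_prop
    obtain ⟨x, hx, hmin⟩ := (isCompact_sphere (0 : EuclideanSpace ℝ (Fin n)) 1).exists_isMinOn
      ⟨v ⟨0, hn⟩, by simpa using hv.1 ⟨0, hn⟩⟩ hc.continuousOn
    refine ⟨x, by simpa using hx, fun Y hY hT => ?_⟩
    obtain ⟨y, hy, h⟩ := sdp_key A v hv lam heig Y hY hT
    have h2 := hmin (show y ∈ Metric.sphere (0 : EuclideanSpace ℝ (Fin n)) 1 by simpa using hy)
    simp only [sdp_rank_one]
    rw [← h]
    exact h2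
end
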